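/- For every real ε one has P(1/3, ε) = (16/27)(ε − 1)²(ε² − 4ε + 1); in particular, for ε ∈ (0, 1] one has P(1/3, ε) = 0 if and only if ε = 2 − √3 or ε = 1. Moreover, for every ε with 0 < ε < 1, the largest real root of the cubic z ↦ P(z, ε) lies in the open interval (1/3, 1/2). -/

import Mathlib

/-- The cubic polynomial `P(z, ε)`. -/
def Pcub (z ε : ℝ) : ℝ :=
  (ε ^ 4 + 16 * ε ^ 2 + 64) * z ^ 3
    + (2 * ε ^ 4 - 20 * ε ^ 3 - 24 * ε ^ 2 + 160 * ε - 64) * z ^ 2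
    + (ε ^ 4 - 16 * ε ^ 3 + 84 * ε ^ 2 - 112 * ε + 16) * z
    + ε * (4 * ε ^ 2 - 20 * ε + 16)

theorem Pcub_one_third (ε : ℝ) :
    Pcub (1 / 3) ε = 16 / 27 * (ε - 1) ^ 2 * (ε ^ 2 - 4 * ε + 1) := by
  unfold Pcub
  ring

theorem Pcub_pos_of_half_le {z ε : ℝ} (h0 : 0 < ε) (h1 : ε < 1) (hz : 1 / 2 ≤ z) :
    0 < Pcub z ε := by
  obtain ⟨w, hw, rfl⟩ : ∃ w : ℝ, 0 ≤ w ∧ z = 1 / 2 + w := ⟨z - 1 / 2, by linarith, by ring⟩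
  have taylor : Pcub (1 / 2 + w) ε = (ε ^ 4 + 16 * ε ^ 2 + 64) * w ^ 3
      + (7 / 2 * ε ^ 4 + 20 * ε * (1 - ε ^ 2) + 140 * ε + 32) * w ^ 2
      + (15 / 4 * ε ^ 4 + 36 * ε ^ 2 * (1 - ε) + 36 * ε ^ 2 + 48 * ε) * w
      + 9 / 8 * ε ^ 2 * (4 - ε) ^ 2 := by
    unfold Pcub
    ring
  have hε : 0 < 1 - ε := by linarith
  have hε2 : 0 < 1 - ε ^ 2 := by nlinarith
  have hε4 : 0 < 4 - ε := by linarith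
  rw [taylor]
  positivity

theorem exists_Pcub_neg {ε : ℝ} (h0 : 0 < ε) (h1 : ε < 1) :
    ∃ z : ℝ, 1 / 3 ≤ z ∧ z < 1 / 2 ∧ Pcub z ε < 0 := by
  rcases le_total ε (3 / 10) with h | h
  · refine ⟨1 / 2 - 3 / 4 * ε + 15 / 16 * ε ^ 2, by nlinarith [sq_nonneg (ε - 2 / 5)],
      by nlinarith, ?_⟩
    have expand : Pcub (1 / 2 - 3 / 4 * ε + 15 / 16 * ε ^ 2) ε = ε ^ 5 * ((-165888 + 457344 * ε
        - 223488 * ε ^ 2 + 73080 * ε ^ 3 - 8100 * ε ^ 4 + 3375 * ε ^ 5) / 4096) := by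
      unfold Pcub
      ring
    have h3 : ε ^ 3 ≤ (3 / 10) ^ 3 := by gcongr
    have h5 : ε ^ 5 ≤ (3 / 10) ^ 5 := by gcongr
    rw [expand]
    refine mul_neg_of_pos_of_neg (by positivity) ?_
    linarith [sq_nonneg ε, pow_pos h0 4]
  · refine ⟨1 / 3, le_rfl, by norm_num, ?_⟩
    rw [Pcub_one_third]
    have hε : 0 < (ε - 1) ^ 2 := by nlinarith
    have hq : ε ^ 2 - 4 * ε + 1 < 0 := by nlinarith
    exact mul_neg_of_pos_of_neg (by positivity) hq

theorem Pcub_one_third_eq_zero_iff {ε : ℝ} (h1 : ε ≤ 1) :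
    Pcub (1 / 3) ε = 0 ↔ ε = 2 - Real.sqrt 3 ∨ ε = 1 := by
  have hs : Real.sqrt 3 ^ 2 = 3 := Real.sq_sqrt (by norm_num)
  have hfac : Pcub (1 / 3) ε =
      16 / 27 * (ε - 1) ^ 2 * ((ε - (2 - Real.sqrt 3)) * (ε - (2 + Real.sqrt 3))) := by
    rw [Pcub_one_third]
    linear_combination 16 / 27 * (ε - 1) ^ 2 * hs
  have hne : ε - (2 + Real.sqrt 3) ≠ 0 := by
    have := Real.sqrt_nonneg 3
    linarith
  rw [hfac]
  simp [hne, sub_eq_zero, or_comm]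

theorem exists_largest_root_Pcub {ε : ℝ} (h0 : 0 < ε) (h1 : ε < 1) :
    ∃ w : ℝ, Pcub w ε = 0 ∧ 1 / 3 < w ∧ w < 1 / 2 ∧ ∀ z : ℝ, Pcub z ε = 0 → z ≤ w := by
  obtain ⟨a, ha, ha', hneg⟩ := exists_Pcub_neg h0 h1
  have hcont : Continuous fun z => Pcub z ε := by
    unfold Pcub
    fun_prop
  have hlt : ∀ z : ℝ, Pcub z ε = 0 → z < 1 / 2 := fun z hz => by
    by_contra! h
    exact (Pcub_pos_of_half_le h0 h1 h).ne' hz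
  have hcompact : IsCompact (Set.Icc a (1 / 2) ∩ {z | Pcub z ε = 0}) :=
    isCompact_Icc.inter_right (isClosed_eq hcont continuous_const)
  obtain ⟨r, hr, hr0⟩ := intermediate_value_Icc ha'.le hcont.continuousOn
    ⟨hneg.le, (Pcub_pos_of_half_le h0 h1 le_rfl).le⟩
  obtain ⟨w, ⟨hw, hw0 : Pcub w ε = 0⟩, hmax⟩ := hcompact.exists_isGreatest ⟨r, hr, hr0⟩
  have haw : a < w := lt_of_le_of_ne hw.1 fun h => by
    rw [h] at hneg
    exact hneg.ne hw0
  refine ⟨w, hw0, ha.trans_lt haw, hlt w hw0, fun z hz => ?_⟩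
  rcases le_total z a with h | h
  · exact h.trans haw.le
  · exact hmax ⟨⟨h, (hlt z hz).le⟩, hz⟩

/-- `P(1/3, ε) = (16/27)(ε − 1)²(ε² − 4ε + 1)`; for `ε ∈ (0, 1]`, `P(1/3, ε) = 0` iff
`ε = 2 − √3` or `ε = 1`; and for `0 < ε < 1` the largest real root of `z ↦ P(z, ε)`
lies in `(1/3, 1/2)`. -/
theorem Pcub_largest_root :
    (∀ ε : ℝ, Pcub (1 / 3) ε = 16 / 27 * (ε - 1) ^ 2 * (ε ^ 2 - 4 * ε + 1)) ∧
    (∀ ε : ℝ, 0 < ε → ε ≤ 1 → (Pcub (1 / 3) ε = 0 ↔ ε = 2 - Real.sqrt 3 ∨ ε = 1)) ∧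
    (∀ ε : ℝ, 0 < ε → ε < 1 → ∃ w : ℝ, Pcub w ε = 0 ∧ 1 / 3 < w ∧ w < 1 / 2 ∧
      ∀ z : ℝ, Pcub z ε = 0 → z ≤ w) :=
  ⟨Pcub_one_third, fun _ _ h1 => Pcub_one_third_eq_zero_iff h1,
    fun _ h0 h1 => exists_largest_root_Pcub h0 h1⟩
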